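/- arXiv:1104.3675 — 4 statements merged into one kernel-verified Lean document; each statement's English description precedes it below -/
import Mathlib

section
/- Let w ∈ CNV_- and let Ψ̂_w(t) = lim_{c→∞} c^{−1} w(ct) be its indicator. Define g_w(t) = sup { v(t) : v ∈ CNV_- and there exists C ≥ 0 with v(s) ≤ w(s) + C for all s ∈ ℝ^n_- }. Then g_w(t) = Ψ̂_w(t) for every t ∈ ℝ^n_-. (This is the convex-image form of the theorem that the complete greenification of a multi-circled plurisubharmonic singularity in the unit polydisk coincides with its indicator.) -/
open MeasureTheory Set Filter

/-- The open negative orthant in `ℝ^n`. -/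
def negOrth (n : ℕ) : Set (Fin n → ℝ) := {t | ∀ j, t j < 0}

/-- The class `CNV₋`: convex, negative functions on the negative orthant that are
nondecreasing in each variable. -/
def CNVm (n : ℕ) (w : (Fin n → ℝ) → ℝ) : Prop :=
  ConvexOn ℝ (negOrth n) w ∧ (∀ t ∈ negOrth n, w t < 0) ∧
    ∀ t ∈ negOrth n, ∀ s ∈ negOrth n, (∀ j, t j ≤ s j) → w t ≤ w s

theorem ConvexOn.exists_subgradient {E : Type*} [NormedAddCommGroup E] [NormedSpace ℝ E]
    [FiniteDimensional ℝ E] {U : Set E} {f : E → ℝ} (hU : IsOpen U) (hf : ConvexOn ℝ U f)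
    {p : E} (hp : p ∈ U) :
    ∃ a : E →L[ℝ] ℝ, ∀ s ∈ U, f p + a (s - p) ≤ f s := by
  have hopen : IsOpen {q : E × ℝ | q.1 ∈ U ∧ f q.1 < q.2} := by
    have h1 : ContinuousOn (fun q : E × ℝ => q.2 - f q.1) (Prod.fst ⁻¹' U) :=
      continuousOn_snd.sub ((hf.continuousOn hU).comp continuousOn_fst fun q hq => hq)
    convert h1.isOpen_inter_preimage (hU.preimage continuous_fst) (isOpen_Ioi (a := 0)) using 1
    ext q
    simp
  obtain ⟨L, hL⟩ := geometric_hahn_banach_open_point hf.convex_strict_epigraph hopen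
    (x := (p, f p)) (by simp)
  have hsplit : ∀ x r, L (x, r) = L (x, 0) + r * L (0, 1) := by
    intro x r
    rw [← smul_eq_mul, ← map_smul, ← map_add]
    simp
  have hk : L (0, 1) < 0 := by
    have h := hL (p, f p + 1) ⟨hp, by simp⟩
    rw [hsplit p (f p + 1), hsplit p (f p)] at h
    linarith
  refine ⟨(-L (0, 1))⁻¹ • L.comp (ContinuousLinearMap.inl ℝ E ℝ), fun s hs => ?_⟩
  refine le_of_forall_gt_imp_ge_of_dense fun r hr => ?_
  have h := hL (s, r) ⟨hs, hr⟩
  rw [hsplit s r, hsplit p (f p)] at h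
  have hsub : L (s - p, 0) = L (s, 0) - L (p, 0) := by
    rw [← map_sub]
    simp
  have hdiv : (-L (0, 1))⁻¹ * L (s - p, 0) ≤ r - f p := by
    rw [inv_mul_le_iff₀ (by linarith), hsub]
    linarith
  simp only [smul_apply, ContinuousLinearMap.comp_apply,
    ContinuousLinearMap.inl_apply, smul_eq_mul]
  linarith

theorem isOpen_negOrth (n : ℕ) : IsOpen (negOrth n) := by
  simp only [negOrth, ofPred_forall]
  exact isOpen_iInter_of_finite fun j => isOpen_lt (continuous_apply j) continuous_const

theorem smul_mem_negOrth {n : ℕ} {t : Fin n → ℝ} (ht : t ∈ negOrth n) {c : ℝ} (hc : 0 < c) :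
    c • t ∈ negOrth n :=
  fun j => mul_neg_of_pos_of_neg hc (ht j)

/-- A subgradient of `w ∈ CNV₋` at `p` is a nonnegative functional `a`, and the supporting
affine function is nonpositive at the origin. -/
theorem CNVm.exists_subgradient {n : ℕ} {w : (Fin n → ℝ) → ℝ} (hw : CNVm n w)
    {p : Fin n → ℝ} (hp : p ∈ negOrth n) :
    ∃ a : (Fin n → ℝ) →L[ℝ] ℝ, (∀ d, 0 ≤ d → 0 ≤ a d) ∧
      (∀ s ∈ negOrth n, w p + a (s - p) ≤ w s) ∧ w p ≤ a p := by
  obtain ⟨hconv, hneg, hmono⟩ := hw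
  obtain ⟨a, ha⟩ := hconv.exists_subgradient (isOpen_negOrth n) hp
  have hpos : ∀ d, 0 ≤ d → 0 ≤ a d := by
    intro d hd
    have hle : ∀ j, (p - d) j ≤ p j := fun j => sub_le_self _ (hd j)
    have hs : p - d ∈ negOrth n := fun j => (hle j).trans_lt (hp j)
    have h1 := ha _ hs
    have h2 := hmono _ hs _ hp hle
    rw [sub_sub_cancel_left, map_neg] at h1
    linarith
  refine ⟨a, hpos, ha, ?_⟩
  have hap : 0 ≤ -a p := by
    rw [← map_neg]
    exact hpos _ fun j => neg_nonneg.2 (hp j).le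
  by_contra! hlt
  have hε : 0 < (w p - a p) / (-a p + 1) := div_pos (by linarith) (by linarith)
  have hmul : (w p - a p) / (-a p + 1) * (-a p + 1) = w p - a p :=
    div_mul_cancel₀ _ (by linarith)
  have hs := smul_mem_negOrth hp hε
  have h1 := ha _ hs
  have h2 := hneg _ hs
  rw [map_sub, map_smul, smul_eq_mul] at h1
  linarith

/-- Along rays, `c ↦ c⁻¹ v(ct)` dominates its value at `c = 1` for `c ≥ 1`. -/
theorem CNVm.le_inv_mul_smul {n : ℕ} {v : (Fin n → ℝ) → ℝ} (hv : CNVm n v)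
    {t : Fin n → ℝ} (ht : t ∈ negOrth n) {c : ℝ} (hc : 1 ≤ c) :
    v t ≤ c⁻¹ * v (c • t) := by
  obtain ⟨a, -, ha, hat⟩ := hv.exists_subgradient ht
  have h := ha _ (smul_mem_negOrth ht (by linarith : 0 < c))
  rw [map_sub, map_smul, smul_eq_mul] at h
  rw [le_inv_mul_iff₀ (by linarith)]
  nlinarith

theorem CNVm_sub_const_of_nonneg {n : ℕ} (a : (Fin n → ℝ) →L[ℝ] ℝ) (ha : ∀ d, 0 ≤ d → 0 ≤ a d)
    {δ : ℝ} (hδ : 0 < δ) : CNVm n fun s => a s - δ := by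
  have hconv : Convex ℝ (negOrth n) := by
    simp only [negOrth, ofPred_forall]
    exact convex_iInter fun j => convex_halfSpace_lt (LinearMap.proj j).isLinear 0
  refine ⟨?_, fun t ht => ?_, fun t _ s _ hts => ?_⟩
  · exact (a.toLinearMap.convexOn hconv).sub (concaveOn_const δ hconv)
  · have h := ha (-t) fun j => neg_nonneg.2 (ht j).le
    rw [map_neg] at h
    linarith
  · have h := ha (s - t) fun j => sub_nonneg.2 (hts j)
    rw [map_sub] at h
    linarith

/-- For `w ∈ CNV₋` with indicator `Ψ̂_w(t) = lim_{c→∞} c⁻¹ w(ct)`,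
the greenification `g_w(t) = sup {v(t) : v ∈ CNV₋, v ≤ w + O(1)}` equals `Ψ̂_w(t)`
for every `t` in the negative orthant. -/
theorem greenification_eq_indicator {n : ℕ} (hn : 1 ≤ n)
    (w Ψ : (Fin n → ℝ) → ℝ) (hw : CNVm n w)
    (hΨ : ∀ t ∈ negOrth n,
      Tendsto (fun c : ℝ => c⁻¹ * w (c • t)) atTop (nhds (Ψ t))) :
    ∀ t ∈ negOrth n,
      IsLUB {x : ℝ | ∃ v : (Fin n → ℝ) → ℝ, CNVm n v ∧
        (∃ C : ℝ, 0 ≤ C ∧ ∀ s ∈ negOrth n, v s ≤ w s + C) ∧ x = v t} (Ψ t) := by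
  intro t ht
  constructor
  · rintro _ ⟨v, hv, ⟨C, -, hC⟩, rfl⟩
    have hlim : Tendsto (fun c : ℝ => c⁻¹ * w (c • t) + c⁻¹ * C) atTop (nhds (Ψ t)) := by
      simpa using (hΨ t ht).add (tendsto_inv_atTop_zero.mul_const C)
    refine ge_of_tendsto hlim ?_
    filter_upwards [eventually_ge_atTop 1] with c hc
    have hc0 : 0 < c := by linarith
    rw [← mul_add]
    exact (hv.le_inv_mul_smul ht hc).trans
      (mul_le_mul_of_nonneg_left (hC _ (smul_mem_negOrth ht hc0)) (inv_nonneg.2 hc0.le))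
  · intro b hb
    refine le_of_tendsto (hΨ t ht) ?_
    filter_upwards [eventually_gt_atTop 0] with c hc
    obtain ⟨a, hpos, hsub, hap⟩ := hw.exists_subgradient (smul_mem_negOrth ht hc)
    have hat : c⁻¹ * w (c • t) ≤ a t := by
      rw [inv_mul_le_iff₀ hc]
      simpa using hap
    refine hat.trans (le_of_forall_pos_le_add fun δ hδ => ?_)
    rw [← sub_le_iff_le_add]
    refine hb ⟨fun s => a s - δ, CNVm_sub_const_of_nonneg a hpos hδ,
      ⟨a (c • t) - w (c • t), sub_nonneg.2 hap, fun s hs => ?_⟩, rfl⟩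
    have h := hsub s hs
    rw [map_sub] at h
    linarith
end

section
/- Let Γ ⊆ {b ∈ ℝ^n : b_j ≥ 0 for all j} be a nonempty closed convex set with Γ + {b ∈ ℝ^n : b_j ≥ 0 ∀j} ⊆ Γ and vol(ℝ^n_+ \ Γ) < ∞. For a ∈ ℝ^n_+ set ν_Γ(a) = inf_{b∈Γ} ⟨a,b⟩. Then sup_{a ∈ ℝ^n_+} ν_Γ(a)/(∑_i a_i) ≤ n^{−1} (n!·vol(ℝ^n_+ \ Γ))^{1/n}. (Convex-geometric form of the inequality λ_u ≤ n^{−1} L_n(u)^{1/n} between the integrability index and the residual Monge–Ampère mass for multi-circled plurisubharmonic singularities with isolated singularity.) -/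
open MeasureTheory Set Filter

/-- The open positive orthant in `ℝ^n`. -/
def posOrth (n : ℕ) : Set (Fin n → ℝ) := {a | ∀ j, 0 < a j}

/-- The part of the unit `ℓ¹` ball lying in the open orthant with signs `s` is the image of
a simplex under a diagonal map. -/
theorem volume_signed_orthant_l1_ball {n : ℕ} (c : Fin n → ℝ) (hc : ∀ i, 0 < c i)
    (s : Fin n → Bool) :
    volume {x : Fin n → ℝ | ∑ i, |x i| < 1 ∧ ∀ i, 0 < (if s i then 1 else -1) * x i} =
      ENNReal.ofReal (∏ i, c i) * volume {x ∈ posOrth n | ∑ i, c i * x i < 1} := by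
  set B := {x : Fin n → ℝ | ∑ i, |x i| < 1 ∧ ∀ i, 0 < (if s i then 1 else -1) * x i}
  have hB : IsOpen B := by
    have h1 : IsOpen {x : Fin n → ℝ | ∑ i, |x i| < 1} := isOpen_lt (by fun_prop) (by fun_prop)
    have h2 : IsOpen (⋂ i, {x : Fin n → ℝ | 0 < (if s i then 1 else -1) * x i}) :=
      isOpen_iInter_of_finite fun i => isOpen_lt (by fun_prop) (by fun_prop)
    convert h1.inter h2
    ext x
    simp [B]
  have habs : ∀ i, |(if s i then 1 else -1) * c i| = c i := by
    intro i
    split_ifs <;> simp [abs_of_pos (hc i)]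
  have hdet : |(Matrix.diagonal fun i => (if s i then 1 else -1) * c i).det| = ∏ i, c i := by
    rw [Matrix.det_diagonal, Finset.abs_prod]
    exact Finset.prod_congr rfl fun i _ => habs i
  have hdet0 : (Matrix.diagonal fun i => (if s i then 1 else -1) * c i).det ≠ 0 := by
    rw [← abs_pos, hdet]
    exact Finset.prod_pos fun i _ => hc i
  conv_lhs => rw [← Real.smul_map_diagonal_volume_pi hdet0]
  rw [Measure.smul_apply, smul_eq_mul, hdet, Measure.map_apply
    (LinearMap.continuous_on_pi _).measurable hB.measurableSet]
  congr 2
  ext x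
  have hpos : (∀ i, 0 < (if s i then (1 : ℝ) else -1) * ((if s i then 1 else -1) * c i * x i)) ↔
      x ∈ posOrth n := by
    refine forall_congr' fun i => ?_
    split_ifs <;> simp [hc i]
  simp only [B, mem_preimage, mem_ofPred_eq, Matrix.toLin'_apply, Matrix.mulVec_diagonal, hpos]
  rw [and_comm]
  refine and_congr_right fun hx => ?_
  simp only [abs_mul _ (x _), habs, abs_of_pos (hx _)]

/-- Lower bound for the volume of the simplex cut from the positive orthant by `∑ cᵢ xᵢ < 1`. -/
theorem inv_factorial_le_volume_simplex {n : ℕ} (c : Fin n → ℝ) (hc : ∀ i, 0 < c i) :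
    ENNReal.ofReal ((n.factorial : ℝ)⁻¹) ≤
      ENNReal.ofReal (∏ i, c i) * volume {x ∈ posOrth n | ∑ i, c i * x i < 1} := by
  have hball : volume {x : Fin n → ℝ | ∑ i, |x i| < 1} =
      2 ^ n * ENNReal.ofReal ((n.factorial : ℝ)⁻¹) := by
    have h := volume_sum_rpow_lt_one (Fin n) (p := 1) le_rfl
    have h2 : Real.Gamma (1 + 1) = 1 := by simpa using Real.Gamma_nat_eq_factorial 1
    simp only [Real.rpow_one, div_one, Fintype.card_fin, Real.Gamma_nat_eq_factorial,
      h2, mul_one] at h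
    rw [h, div_eq_mul_inv, ENNReal.ofReal_mul (by positivity), ENNReal.ofReal_pow (by norm_num)]
    simp
  have hcover : {x : Fin n → ℝ | ∑ i, |x i| < 1} ≤ᵐ[volume] ⋃ s : Fin n → Bool,
      {x : Fin n → ℝ | ∑ i, |x i| < 1 ∧ ∀ i, 0 < (if s i then 1 else -1) * x i} := by
    have h0 : ∀ᵐ x : Fin n → ℝ, ∀ i, x i ≠ 0 :=
      ae_all_iff.2 fun i => Measure.ae_eval_ne (fun _ => volume) i 0
    filter_upwards [h0] with x hx hx1
    refine mem_iUnion.2 ⟨fun i => decide (0 < x i), hx1, fun i => ?_⟩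
    rcases (hx i).lt_or_gt with h | h
    · simp [h, h.not_gt]
    · simp [h]
  have h := (measure_mono_ae hcover).trans (measure_iUnion_le _)
  simp only [volume_signed_orthant_l1_ball c hc, hball, tsum_fintype, Finset.sum_const,
    Finset.card_univ, Fintype.card_pi, Fintype.card_bool, Finset.prod_const, Fintype.card_fin,
    nsmul_eq_mul, Nat.cast_pow, Nat.cast_ofNat] at h
  exact (ENNReal.mul_le_mul_iff_right (by simp) (by finiteness)).1 h

/-- Convex-geometric form of `λ_u ≤ n⁻¹ L_n(u)^{1/n}`: for a
nonempty closed convex `Γ` in the closed positive orthant with `Γ + ℝ̄ⁿ₊ ⊆ Γ` and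
finite covolume, `sup_{a ∈ ℝⁿ₊} ν_Γ(a)/∑ aᵢ ≤ n⁻¹ (n!·vol(ℝⁿ₊ \ Γ))^{1/n}`. -/
theorem covolume_index_bound {n : ℕ} (hn : 1 ≤ n) (Γ : Set (Fin n → ℝ))
    (hΓ : Γ ⊆ {b | ∀ j, 0 ≤ b j}) (hne : Γ.Nonempty)
    (hcl : IsClosed Γ) (hcv : Convex ℝ Γ)
    (hup : ∀ x ∈ Γ, ∀ b : Fin n → ℝ, (∀ j, 0 ≤ b j) → x + b ∈ Γ)
    (hvol : volume (posOrth n \ Γ) < ⊤) :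
    ∀ a ∈ posOrth n, ∀ ν : ℝ,
      IsGLB ((fun b : Fin n → ℝ => ∑ i, a i * b i) '' Γ) ν →
      ν / (∑ i, a i) ≤
        (n : ℝ)⁻¹ * ((n.factorial : ℝ) * (volume (posOrth n \ Γ)).toReal) ^ ((n : ℝ)⁻¹) := by
  intro a ha ν hν
  have : NeZero n := ⟨by omega⟩
  have hsum : 0 < ∑ i, a i := Finset.sum_pos (fun i _ => ha i) Finset.univ_nonempty
  rcases le_or_gt ν 0 with hν0 | hν0
  · exact (div_nonpos_of_nonpos_of_nonneg hν0 hsum.le).trans (by positivity)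
  have hc : ∀ i, 0 < a i / ν := fun i => div_pos (ha i) hν0
  have hsub : {x ∈ posOrth n | ∑ i, a i / ν * x i < 1} ⊆ posOrth n \ Γ := by
    rintro x ⟨hx, hx1⟩
    refine ⟨hx, fun hxΓ => hx1.not_ge ?_⟩
    have h : ν ≤ ∑ i, a i * x i := hν.1 (mem_image_of_mem _ hxΓ)
    simp only [div_mul_eq_mul_div]
    rwa [← Finset.sum_div, le_div_iff₀ hν0, one_mul]
  have hprod : 0 ≤ ∏ i, a i / ν := Finset.prod_nonneg fun i _ => (hc i).le
  set V := (volume (posOrth n \ Γ)).toReal with hV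
  have hV0 : 0 ≤ V := ENNReal.toReal_nonneg
  have hle : (n.factorial : ℝ)⁻¹ ≤ (∏ i, a i / ν) * V := by
    have h := (inv_factorial_le_volume_simplex _ hc).trans (mul_le_mul_right (measure_mono hsub) _)
    rwa [← ENNReal.ofReal_toReal hvol.ne, ← ENNReal.ofReal_mul hprod,
      ENNReal.ofReal_le_ofReal_iff (by positivity)] at h
  have hone : 1 ≤ (∏ i, a i / ν) * ((n.factorial : ℝ) * V) := by
    rw [inv_le_iff_one_le_mul₀' (by positivity)] at hle
    linarith
  have hamgm : (∏ i, a i / ν) ^ ((n : ℝ)⁻¹) ≤ (∑ i, a i) / ν / n := by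
    have h := Real.geom_mean_le_arith_mean Finset.univ (fun _ => 1) (fun i => a i / ν)
      (fun _ _ => zero_le_one) (by simp; omega) (fun i _ => (hc i).le)
    simpa [← Finset.sum_div] using h
  have hroot : 1 ≤ (∏ i, a i / ν) ^ ((n : ℝ)⁻¹) * ((n.factorial : ℝ) * V) ^ ((n : ℝ)⁻¹) := by
    rw [← Real.mul_rpow hprod (by positivity)]
    exact Real.one_le_rpow hone (by positivity)
  have hfin := hroot.trans (mul_le_mul_of_nonneg_right hamgm (by positivity))
  rw [div_le_iff₀ hsum]
  calc ν = ν * 1 := (mul_one ν).symm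
    _ ≤ ν * ((∑ i, a i) / ν / n * ((n.factorial : ℝ) * V) ^ ((n : ℝ)⁻¹)) := by gcongr
    _ = _ := by field_simp
end

section
/- Let Γ ⊆ {b ∈ ℝ^n : b_j ≥ 0 for all j} be a nonempty closed convex set with Γ + {b ∈ ℝ^n : b_j ≥ 0 ∀j} ⊆ Γ and vol(ℝ^n_+ \ Γ) < ∞, and set ν_Γ(a) = inf_{b∈Γ} ⟨a,b⟩ for a ∈ ℝ^n_+. Then equality sup_{a ∈ ℝ^n_+} ν_Γ(a)/(∑_i a_i) = n^{−1} (n!·vol(ℝ^n_+ \ Γ))^{1/n} holds if and only if there exists B ≥ 0 such that Γ = {b ∈ ℝ^n : b_j ≥ 0 for all j, ∑_j b_j ≥ B}. (Convex-geometric form of the characterization of equality λ_u = n^{−1} L_n(u)^{1/n} for multi-circled singularities: equality holds exactly when the indicator is Ψ_u(z) = B·max_j log|z_j|.) -/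
open MeasureTheory Set Filter

theorem isOpen_posOrth (n : ℕ) : IsOpen (posOrth n) := by
  have : posOrth n = ⋂ j, {a : Fin n → ℝ | 0 < a j} := by
    ext a
    simp [posOrth]
  rw [this]
  exact isOpen_iInter_of_finite fun j => isOpen_lt continuous_const (continuous_apply j)

theorem isOpen_corner_simplex {n : ℕ} (a : Fin n → ℝ) (c : ℝ) :
    IsOpen {b : Fin n → ℝ | (∀ j, 0 < b j) ∧ ∑ j, a j * b j < c} := by
  have h : IsOpen {b : Fin n → ℝ | ∑ j, a j * b j < c} :=
    isOpen_lt (by fun_prop) continuous_const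
  exact (isOpen_posOrth n).inter h

open Finset in
/-- The volume of an open corner simplex `{b > 0 : ⟨a, b⟩ < c}`. -/
theorem volume_corner_simplex (n : ℕ) (a : Fin n → ℝ) (ha : ∀ j, 0 < a j) (c : ℝ) (hc : 0 < c) :
    volume {b : Fin n → ℝ | (∀ j, 0 < b j) ∧ ∑ j, a j * b j < c} =
      ENNReal.ofReal (c ^ n / (n.factorial * ∏ j, a j)) := by
  induction n generalizing c with
  | zero => simp [hc, volume_pi]
  | succ n ih =>
    set S := {b : Fin (n + 1) → ℝ | (∀ j, 0 < b j) ∧ ∑ j, a j * b j < c}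
    have hS : MeasurableSet S := (isOpen_corner_simplex a c).measurableSet
    set e := MeasurableEquiv.piFinSuccAbove (fun _ : Fin (n + 1) => ℝ) 0
    have he := (volume_preserving_piFinSuccAbove (fun _ : Fin (n + 1) => ℝ) 0).symm
    have ha0 := ha 0
    set P := ∏ j : Fin n, a j.succ with hP
    have hPpos : 0 < P := prod_pos fun j _ => ha _
    have hslice : ∀ x : ℝ, volume (Prod.mk x ⁻¹' (e.symm ⁻¹' S)) =
        (Set.Ioo 0 (c / a 0)).indicator
          (fun x => ENNReal.ofReal ((c - a 0 * x) ^ n / (n.factorial * P))) x := by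
      intro x
      have hpre : Prod.mk x ⁻¹' (e.symm ⁻¹' S) =
          {b : Fin n → ℝ | 0 < x ∧ (∀ j, 0 < b j) ∧ ∑ j, a j.succ * b j < c - a 0 * x} := by
        ext b
        simp only [S, e, Set.mem_preimage, Set.mem_ofPred_eq, Fin.forall_fin_succ, Fin.sum_univ_succ,
          MeasurableEquiv.piFinSuccAbove_symm_apply, Fin.insertNthEquiv_zero, Fin.consEquiv_apply,
          Fin.cons_zero, Fin.cons_succ, lt_sub_iff_add_lt', and_assoc]
      rw [hpre]
      by_cases hx0 : 0 < x
      swap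
      · rw [Set.indicator_of_notMem (fun h => hx0 h.1)]
        simp [hx0]
      rcases lt_or_ge 0 (c - a 0 * x) with hcx | hcx
      · rw [Set.indicator_of_mem]
        · simp only [hx0, true_and]
          exact ih (fun j => a j.succ) (fun j => ha _) _ hcx
        · refine ⟨hx0, ?_⟩
          rw [lt_div_iff₀ ha0]; linarith
      · have hempty : {b : Fin n → ℝ | 0 < x ∧ (∀ j, 0 < b j) ∧
            ∑ j, a j.succ * b j < c - a 0 * x} = ∅ := by
          ext b
          simp only [Set.mem_ofPred_eq, Set.mem_empty_iff_false, iff_false, not_and, not_lt]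
          intro _ hb
          exact hcx.trans (sum_nonneg fun j _ => (mul_pos (ha _) (hb j)).le)
        rw [hempty, measure_empty]
        rw [Set.indicator_of_notMem]
        intro hx
        have h2 := hx.2
        rw [lt_div_iff₀ ha0] at h2
        linarith
    rw [← he.measure_preimage_equiv, Measure.volume_eq_prod, Measure.prod_apply (by measurability)]
    have hca : 0 ≤ c / a 0 := by positivity
    rw [lintegral_congr hslice, lintegral_indicator measurableSet_Ioo,
      setLIntegral_congr Ioo_ae_eq_Ioc, ← ofReal_integral_eq_lintegral_ofReal]
    · rw [← intervalIntegral.integral_of_le hca, intervalIntegral.integral_div,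
        intervalIntegral.integral_comp_sub_mul (fun y => y ^ n) ha0.ne', integral_pow,
        mul_div_cancel₀ _ ha0.ne', Fin.prod_univ_succ, ← hP, Nat.factorial_succ]
      congr 1
      have := Nat.factorial_pos n
      push_cast
      simp
      field_simp
    · exact (Continuous.integrableOn_Icc (by fun_prop)).mono_set Ioc_subset_Icc_self
    · filter_upwards [ae_restrict_mem measurableSet_Ioc] with x hx
      have h2 := hx.2
      rw [le_div_iff₀ ha0] at h2
      have : 0 ≤ c - a 0 * x := by linarith
      positivity

/-- The equality case of the inequality of arithmetic and geometric means. -/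
theorem eq_of_sum_pow_le_prod {n : ℕ} (hn : 1 ≤ n) (a : Fin n → ℝ) (ha : ∀ j, 0 < a j)
    (h : (∑ j, a j) ^ n ≤ (n : ℝ) ^ n * ∏ j, a j) (i j : Fin n) : a i = a j := by
  have hn0 : (0 : ℝ) < n := by exact_mod_cast hn
  have hw : ∑ _j : Fin n, (n : ℝ)⁻¹ = 1 := by simp [hn0.ne']
  have hP : 0 ≤ ∏ j, a j := Finset.prod_nonneg fun j _ => (ha j).le
  have hS : 0 ≤ ∑ j, a j := Finset.sum_nonneg fun j _ => (ha j).le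
  refine (Real.geom_mean_eq_arith_mean_weighted_iff_of_pos Finset.univ (fun _ => (n : ℝ)⁻¹) a
    (fun _ _ => inv_pos.2 hn0) hw fun j _ => (ha j).le).1 (le_antisymm ?_ ?_) i (Finset.mem_univ _)
    j (Finset.mem_univ _)
  · exact Real.geom_mean_le_arith_mean_weighted _ _ _ (fun _ _ => (inv_pos.2 hn0).le) hw
      fun j _ => (ha j).le
  · rw [Real.finsetProd_rpow _ _ fun j _ => (ha j).le, ← Finset.mul_sum,
      Real.le_rpow_inv_iff_of_pos (by positivity) hP hn0, Real.rpow_natCast, mul_pow, inv_pow,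
      inv_mul_le_iff₀ (by positivity)]
    exact h

/-- The index `ν_Γ(a) / ∑ aᵢ` is at most `t` as soon as `(t, …, t) ∈ Γ`. -/
theorem sInf_div_sum_le_of_const_mem {n : ℕ} (hn : 1 ≤ n) {Γ : Set (Fin n → ℝ)}
    (hΓ : Γ ⊆ {b | ∀ j, 0 ≤ b j}) {t : ℝ} (ht : (fun _ => t) ∈ Γ) {a : Fin n → ℝ}
    (ha : a ∈ posOrth n) :
    sInf ((fun b : Fin n → ℝ => ∑ i, a i * b i) '' Γ) / ∑ i, a i ≤ t := by
  have : Nonempty (Fin n) := ⟨⟨0, hn⟩⟩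
  have hA : 0 < ∑ i, a i := Finset.sum_pos (fun i _ => ha i) Finset.univ_nonempty
  rw [div_le_iff₀ hA]
  refine csInf_le ⟨0, ?_⟩ ⟨_, ht, ?_⟩
  · rintro _ ⟨b, hb, rfl⟩
    exact Finset.sum_nonneg fun i _ => mul_nonneg (ha i).le (hΓ hb i)
  · simp [Finset.mul_sum, mul_comm]

/-- A supporting hyperplane of an upward closed convex set at a diagonal boundary point. -/
theorem exists_supporting_functional {n : ℕ} (hn : 1 ≤ n) {Γ : Set (Fin n → ℝ)}
    (hne : Γ.Nonempty) (hcv : Convex ℝ Γ)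
    (hup : ∀ x ∈ Γ, ∀ b : Fin n → ℝ, (∀ j, 0 ≤ b j) → x + b ∈ Γ) {t : ℝ}
    (ht : ∀ s < t, (fun _ => s) ∉ Γ) :
    ∃ a : Fin n → ℝ, (∀ j, 0 ≤ a j) ∧ 0 < ∑ j, a j ∧
      ∀ b ∈ Γ, t * ∑ j, a j ≤ ∑ j, a j * b j := by
  have : Nonempty (Fin n) := ⟨⟨0, hn⟩⟩
  set s : Set (Fin n → ℝ) := Set.pi univ fun _ => Iio t with hs
  have hdisj : Disjoint s Γ := by
    rw [Set.disjoint_left]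
    intro b hb hbΓ
    obtain ⟨i, hi⟩ := Finite.exists_max b
    refine ht (b i) (hb i (mem_univ i)) ?_
    convert hup b hbΓ (fun j => b i - b j) fun j => sub_nonneg.2 (hi j) using 1
    ext j
    simp
  obtain ⟨f, u, hfu, huf⟩ := geometric_hahn_banach_open
    (convex_pi fun _ _ => convex_Iio t) (isOpen_set_pi finite_univ fun _ _ => isOpen_Iio) hcv hdisj
  set a : Fin n → ℝ := fun j => f (Pi.single j 1) with ha
  have hf : ∀ b, f b = ∑ j, a j * b j := by
    intro b
    have := LinearMap.pi_apply_eq_sum_univ (f : (Fin n → ℝ) →ₗ[ℝ] ℝ) b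
    simp only [ContinuousLinearMap.coe_coe, smul_eq_mul] at this
    rw [this]
    refine Finset.sum_congr rfl fun j _ => ?_
    rw [mul_comm, ha]
    congr 2
    ext k
    simp [Pi.single_apply, eq_comm]
  have hconst : ∀ r < t, r * ∑ j, a j < u := by
    intro r hr
    have := hfu (fun _ => r) fun _ _ => hr
    rwa [hf, ← Finset.sum_mul, mul_comm] at this
  have ha0 : ∀ j, 0 ≤ a j := by
    intro i
    by_contra! hi
    have hc := hconst (t - 1) (by linarith)
    set r := (u - (t - 1) * ∑ j, a j) / (-a i) with hr
    have hr0 : 0 < r := div_pos (by linarith) (by linarith)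
    have := hfu (fun j => (t - 1) + (Pi.single i (-r) : Fin n → ℝ) j) fun j _ => by
      rcases eq_or_ne j i with rfl | hj
      · simp; linarith
      · simp [hj]
    rw [hf] at this
    simp only [mul_add, Finset.sum_add_distrib, ← Finset.sum_mul, Pi.single_apply, mul_ite,
      mul_zero, Finset.sum_ite_eq', Finset.mem_univ, if_true] at this
    have h2 : r * (-a i) = u - (t - 1) * ∑ j, a j := div_mul_cancel₀ _ (by linarith)
    linarith
  have hApos : 0 < ∑ j, a j := by
    refine (Finset.sum_nonneg fun j _ => ha0 j).lt_of_ne fun h => ?_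
    have hz := (Finset.sum_eq_zero_iff_of_nonneg fun j _ => ha0 j).1 h.symm
    obtain ⟨b, hb⟩ := hne
    have h1 := huf b hb
    rw [hf, Finset.sum_eq_zero fun j hj => by rw [hz j hj, zero_mul]] at h1
    have h2 := hconst (t - 1) (by linarith)
    rw [← h] at h2
    linarith
  refine ⟨a, ha0, hApos, fun b hb => ?_⟩
  rw [← hf]
  refine le_trans ?_ (huf b hb)
  rw [← le_div_iff₀ hApos]
  by_contra! h
  have := hconst _ h
  rw [div_mul_cancel₀ _ hApos.ne'] at this
  exact lt_irrefl _ this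

/-- A supporting functional at a positive diagonal point of a set of finite covolume is positive. -/
theorem supporting_functional_pos {n : ℕ} {Γ : Set (Fin n → ℝ)}
    (hvol : volume (posOrth n \ Γ) < ⊤) {t : ℝ} (ht : 0 < t) {a : Fin n → ℝ}
    (ha : ∀ j, 0 ≤ a j) (hA : 0 < ∑ j, a j)
    (hsupp : ∀ b ∈ Γ, t * ∑ j, a j ≤ ∑ j, a j * b j) (i : Fin n) : 0 < a i := by
  refine (ha i).lt_of_ne fun hi => hvol.ne ?_
  rw [eq_top_iff]
  have hsub : Set.pi univ (fun j => if j = i then Ioi 0 else Ioo 0 t) ⊆ posOrth n \ Γ := by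
    intro b hb
    have hb0 : ∀ j, 0 < b j := by
      intro j
      have := hb j (mem_univ j)
      dsimp only at this
      split_ifs at this
      · exact this
      · exact this.1
    refine ⟨hb0, fun hbΓ => (hsupp b hbΓ).not_gt ?_⟩
    have hbt : ∀ j, j ≠ i → b j < t := by
      intro j hj
      have := hb j (mem_univ j)
      dsimp only at this
      rw [if_neg hj] at this
      exact this.2
    obtain ⟨k, -, hk⟩ := Finset.exists_lt_of_sum_lt (s := Finset.univ) (f := fun _ => (0 : ℝ))
      (g := a) (by simpa using hA)
    rw [Finset.mul_sum]
    refine Finset.sum_lt_sum (fun j _ => ?_) ⟨k, Finset.mem_univ k, ?_⟩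
    · rcases eq_or_ne j i with rfl | hj
      · simp [← hi]
      · rw [mul_comm]
        exact mul_le_mul_of_nonneg_right (hbt j hj).le (ha j)
    · rw [mul_comm]
      refine mul_lt_mul_of_pos_right (hbt k ?_) hk
      rintro rfl
      exact hk.ne hi
  refine le_trans ?_ (measure_mono hsub)
  rw [volume_pi_pi, ← Finset.mul_prod_erase _ _ (Finset.mem_univ i), if_pos rfl, Real.volume_Ioi,
    ENNReal.top_mul]
  refine Finset.prod_ne_zero_iff.2 fun j hj => ?_
  rw [if_neg (Finset.ne_of_mem_erase hj)]
  simpa using ht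

/-- A closed set `Γ` whose complement in the positive orthant has no more volume than the corner
simplex it contains is the corresponding truncated orthant. -/
theorem eq_truncated_orthant {n : ℕ} {Γ : Set (Fin n → ℝ)} (hΓ : Γ ⊆ {b | ∀ j, 0 ≤ b j})
    (hcl : IsClosed Γ) (hn : 1 ≤ n) (hvol : volume (posOrth n \ Γ) < ⊤) {B : ℝ}
    (hsub : ∀ b ∈ Γ, B ≤ ∑ j, b j)
    (hle : volume (posOrth n \ Γ) ≤
      volume {b : Fin n → ℝ | (∀ j, 0 < b j) ∧ ∑ j, 1 * b j < B}) :
    Γ = {b | (∀ j, 0 ≤ b j) ∧ B ≤ ∑ j, b j} := by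
  have : Nonempty (Fin n) := ⟨⟨0, hn⟩⟩
  refine Subset.antisymm (fun b hb => ⟨hΓ hb, hsub b hb⟩) ?_
  rintro b ⟨hb0, hbB⟩
  by_contra hb
  set S := {b : Fin n → ℝ | (∀ j, 0 < b j) ∧ ∑ j, 1 * b j < B}
  have hSo : IsOpen S := isOpen_corner_simplex (fun _ => 1) B
  have hSsub : S ⊆ posOrth n \ Γ := by
    rintro x ⟨hx0, hxB⟩
    refine ⟨hx0, fun hx => (hsub x hx).not_gt ?_⟩
    simpa using hxB
  have hzero : volume ((posOrth n \ Γ) \ S) = 0 := by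
    rw [measure_sdiff hSsub hSo.measurableSet.nullMeasurableSet
      ((measure_mono hSsub).trans_lt hvol).ne]
    exact tsub_eq_zero_of_le hle
  set U := (Γᶜ ∩ posOrth n) ∩ {x : Fin n → ℝ | B < ∑ j, x j}
  have hUo : IsOpen U := (hcl.isOpen_compl.inter (isOpen_posOrth n)).inter
    (isOpen_lt continuous_const (by fun_prop))
  have hUsub : U ⊆ (posOrth n \ Γ) \ S := by
    rintro x ⟨⟨hxΓ, hx0⟩, hxB⟩
    refine ⟨⟨hx0, hxΓ⟩, fun hxS => ?_⟩
    have := hxS.2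
    simp only [one_mul] at this
    exact lt_asymm this hxB
  have hcont : Continuous fun ε : ℝ => fun j => b j + ε := by fun_prop
  have hev : ∀ᶠ ε in nhds (0 : ℝ), (fun j => b j + ε) ∈ Γᶜ :=
    hcont.continuousAt.eventually_mem (hcl.isOpen_compl.mem_nhds (by simpa using hb))
  obtain ⟨ε, hεΓ, hε⟩ :=
    ((hev.filter_mono nhdsWithin_le_nhds).and (self_mem_nhdsWithin (s := Ioi 0))).exists
  have hUne : U.Nonempty := by
    refine ⟨fun j => b j + ε, ⟨hεΓ, fun j => add_pos_of_nonneg_of_pos (hb0 j) hε⟩, ?_⟩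
    exact hbB.trans_lt (Finset.sum_lt_sum_of_nonempty Finset.univ_nonempty
      fun j _ => lt_add_of_pos_right _ hε)
  exact (hUo.measure_pos volume hUne).ne' (measure_mono_null hUsub hzero)

/-- The supremum of the indices of a truncated orthant. -/
theorem isGreatest_index_truncated_orthant {n : ℕ} (hn : 1 ≤ n) {B : ℝ} (hB : 0 ≤ B) :
    IsGreatest {x : ℝ | ∃ a ∈ posOrth n, x = sInf ((fun b : Fin n → ℝ => ∑ i, a i * b i) ''
      {b | (∀ j, 0 ≤ b j) ∧ B ≤ ∑ j, b j}) / ∑ i, a i} ((n : ℝ)⁻¹ * B) := by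
  have hn0 : (0 : ℝ) < n := by exact_mod_cast hn
  have hmem : (fun _ => (n : ℝ)⁻¹ * B) ∈
      {b : Fin n → ℝ | (∀ j, 0 ≤ b j) ∧ B ≤ ∑ j, b j} := by
    refine ⟨fun _ => by positivity, ?_⟩
    simp [hn0.ne']
  constructor
  · refine ⟨fun _ => 1, fun _ => one_pos, ?_⟩
    have hleast : IsLeast ((fun b : Fin n → ℝ => ∑ i, (1 : ℝ) * b i) ''
        {b | (∀ j, 0 ≤ b j) ∧ B ≤ ∑ j, b j}) B := by
      constructor
      · exact ⟨_, hmem, by simp [hn0.ne']⟩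
      · rintro _ ⟨b, hb, rfl⟩
        simpa using hb.2
    rw [hleast.csInf_eq]
    simp [div_eq_inv_mul]
  · rintro _ ⟨a, ha, rfl⟩
    exact sInf_div_sum_le_of_const_mem hn (fun b hb => hb.1) hmem ha

/-- The covolume of a truncated orthant. -/
theorem covolume_truncated_orthant {n : ℕ} (hn : 1 ≤ n) {B : ℝ} (hB : 0 ≤ B) :
    volume (posOrth n \ {b | (∀ j, 0 ≤ b j) ∧ B ≤ ∑ j, b j}) =
      ENNReal.ofReal (B ^ n / n.factorial) := by
  have heq : posOrth n \ {b | (∀ j, 0 ≤ b j) ∧ B ≤ ∑ j, b j} =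
      {b : Fin n → ℝ | (∀ j, 0 < b j) ∧ ∑ j, 1 * b j < B} := by
    ext b
    constructor
    · rintro ⟨hb, hbn⟩
      refine ⟨hb, ?_⟩
      by_contra! h
      exact hbn ⟨fun j => (hb j).le, by simpa using h⟩
    · rintro ⟨hb, hbB⟩
      refine ⟨hb, fun h => h.2.not_gt ?_⟩
      simpa using hbB
  rw [heq]
  rcases hB.eq_or_lt with rfl | hB
  · have : {b : Fin n → ℝ | (∀ j, 0 < b j) ∧ ∑ j, 1 * b j < 0} = ∅ := by
      refine Set.eq_empty_of_forall_notMem fun b hb => hb.2.not_ge ?_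
      exact Finset.sum_nonneg fun j _ => mul_nonneg zero_le_one (hb.1 j).le
    rw [this]
    simp [(Nat.pos_of_ne_zero (by omega : n ≠ 0)).ne']
  · rw [volume_corner_simplex n (fun _ => 1) (fun _ => one_pos) B hB]
    simp

/-- The smallest diagonal point of a nonempty closed upward closed subset of the orthant. -/
theorem exists_least_const_mem {n : ℕ} (hn : 1 ≤ n) {Γ : Set (Fin n → ℝ)}
    (hΓ : Γ ⊆ {b | ∀ j, 0 ≤ b j}) (hne : Γ.Nonempty) (hcl : IsClosed Γ)
    (hup : ∀ x ∈ Γ, ∀ b : Fin n → ℝ, (∀ j, 0 ≤ b j) → x + b ∈ Γ) :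
    ∃ t : ℝ, 0 ≤ t ∧ (fun _ => t) ∈ Γ ∧ ∀ s < t, (fun _ => s) ∉ Γ := by
  have : Nonempty (Fin n) := ⟨⟨0, hn⟩⟩
  set T : Set ℝ := {s | (fun _ => s) ∈ Γ}
  have hTcl : IsClosed T :=
    hcl.preimage (f := fun s : ℝ => fun _ : Fin n => s) (by fun_prop)
  have hT0 : ∀ s ∈ T, 0 ≤ s := fun s hs => hΓ hs ⟨0, hn⟩
  have hTne : T.Nonempty := by
    obtain ⟨b, hb⟩ := hne
    obtain ⟨i, hi⟩ := Finite.exists_max b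
    refine ⟨b i, ?_⟩
    show (fun _ => b i) ∈ Γ
    convert hup b hb (fun j => b i - b j) fun j => sub_nonneg.2 (hi j) using 1
    ext j
    simp
  have hbdd : BddBelow T := ⟨0, hT0⟩
  have hmem := hTcl.csInf_mem hTne hbdd
  exact ⟨sInf T, hT0 _ hmem, hmem, fun s hs h => (csInf_le hbdd h).not_gt hs⟩

/-- Characterization of equality `λ_u = n⁻¹ L_n(u)^{1/n}` in
convex-geometric form: for a nonempty closed convex `Γ` in the closed positive orthant
with `Γ + ℝ̄ⁿ₊ ⊆ Γ` and finite covolume,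
`sup_{a ∈ ℝⁿ₊} ν_Γ(a)/∑ aᵢ = n⁻¹ (n!·vol(ℝⁿ₊ \ Γ))^{1/n}` holds iff
`Γ = {b ≥ 0 : ∑ bⱼ ≥ B}` for some `B ≥ 0`. -/
theorem covolume_index_equality_iff {n : ℕ} (hn : 1 ≤ n) (Γ : Set (Fin n → ℝ))
    (hΓ : Γ ⊆ {b | ∀ j, 0 ≤ b j}) (hne : Γ.Nonempty)
    (hcl : IsClosed Γ) (hcv : Convex ℝ Γ)
    (hup : ∀ x ∈ Γ, ∀ b : Fin n → ℝ, (∀ j, 0 ≤ b j) → x + b ∈ Γ)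
    (hvol : volume (posOrth n \ Γ) < ⊤) :
    sSup {x : ℝ | ∃ a ∈ posOrth n,
        x = sInf ((fun b : Fin n → ℝ => ∑ i, a i * b i) '' Γ) / ∑ i, a i} =
      (n : ℝ)⁻¹ * ((n.factorial : ℝ) * (volume (posOrth n \ Γ)).toReal) ^ ((n : ℝ)⁻¹) ↔
    ∃ B : ℝ, 0 ≤ B ∧ Γ = {b | (∀ j, 0 ≤ b j) ∧ B ≤ ∑ j, b j} := by
  have hn0 : (0 : ℝ) < n := by exact_mod_cast hn
  have hfac : (0 : ℝ) < n.factorial := by exact_mod_cast n.factorial_pos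
  constructor
  · intro heq
    obtain ⟨t, ht0, htΓ, htmin⟩ := exists_least_const_mem hn hΓ hne hcl hup
    rcases ht0.eq_or_lt with rfl | ht
    · refine ⟨0, le_rfl, Subset.antisymm (fun b hb => ⟨hΓ hb, ?_⟩) fun b hb => ?_⟩
      · exact Finset.sum_nonneg fun j _ => hΓ hb j
      · convert hup _ htΓ b hb.1 using 1
        ext j
        simp
    · obtain ⟨a, ha0, hA, hsupp⟩ := exists_supporting_functional hn hne hcv hup htmin
      have ha := supporting_functional_pos hvol ht ha0 hA hsupp
      set V := (volume (posOrth n \ Γ)).toReal with hV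
      have hVle : V ≤ (t * n) ^ n / n.factorial := by
        have hsup : (n : ℝ)⁻¹ * ((n.factorial : ℝ) * V) ^ ((n : ℝ)⁻¹) ≤ t := by
          rw [← heq]
          refine csSup_le ⟨_, fun _ => 1, fun _ => one_pos, rfl⟩ ?_
          rintro _ ⟨a, ha, rfl⟩
          exact sInf_div_sum_le_of_const_mem hn hΓ htΓ ha
        rw [inv_mul_le_iff₀ hn0, Real.rpow_inv_le_iff_of_pos (by positivity) (by positivity) hn0,
          Real.rpow_natCast] at hsup
        rw [le_div_iff₀ hfac, mul_comm, mul_comm t]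
        exact hsup
      have hPpos : 0 < ∏ j, a j := Finset.prod_pos fun j _ => ha j
      have hVge : (t * ∑ j, a j) ^ n / (n.factorial * ∏ j, a j) ≤ V := by
        rw [hV, ← ENNReal.ofReal_le_iff_le_toReal hvol.ne,
          ← volume_corner_simplex n a ha _ (by positivity)]
        refine measure_mono ?_
        rintro b ⟨hb0, hb⟩
        exact ⟨hb0, fun h => (hsupp b h).not_gt hb⟩
      have hamgm : (∑ j, a j) ^ n ≤ (n : ℝ) ^ n * ∏ j, a j := by
        have h := hVge.trans hVle
        rw [div_le_div_iff₀ (by positivity) hfac, mul_pow, mul_pow] at h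
        have hpos : 0 < t ^ n * n.factorial := by positivity
        refine le_of_mul_le_mul_left ?_ hpos
        linarith
      have hconst := eq_of_sum_pow_le_prod hn a ha hamgm
      have hi := ha ⟨0, hn⟩
      have haeq : ∀ j, a j = a ⟨0, hn⟩ := fun j => hconst j _
      have hsub : ∀ b ∈ Γ, t * n ≤ ∑ j, b j := by
        intro b hb
        have h := hsupp b hb
        simp only [haeq] at h
        rw [← Finset.mul_sum, Finset.sum_const, Finset.card_univ, Fintype.card_fin,
          nsmul_eq_mul] at h
        refine le_of_mul_le_mul_left ?_ hi
        linarith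
      refine ⟨t * n, by positivity, eq_truncated_orthant hΓ hcl hn hvol hsub ?_⟩
      rw [volume_corner_simplex n (fun _ => 1) (fun _ => one_pos) _ (by positivity),
        ← ENNReal.ofReal_toReal hvol.ne]
      refine ENNReal.ofReal_le_ofReal ?_
      simpa using hVle
  · rintro ⟨B, hB, rfl⟩
    rw [(isGreatest_index_truncated_orthant hn hB).csSup_eq, covolume_truncated_orthant hn hB,
      ENNReal.toReal_ofReal (by positivity), mul_div_cancel₀ _ hfac.ne',
      Real.pow_rpow_inv_natCast hB (by omega)]
end

section
/- Define w : ℝ²_- → ℝ by w(t₁,t₂) = max(−√(−t₁), t₂) + max(t₁, t₂). Then: (i) w is convex, negative, and nondecreasing in each variable on ℝ²_- (i.e. w ∈ CNV_-); (ii) its indicator satisfies Ψ̂_w(t) = lim_{c→∞} c^{−1} w(ct) = max(t₁,t₂) for every t ∈ ℝ²_-; (iii) the limit superior of w(t)/max(t₁,t₂) as max(t₁,t₂) → −∞ (t ∈ ℝ²_-) equals 2. In particular there exists a multi-circled plurisubharmonic function u, locally bounded outside 0, with limsup_{z→0} u(z)/Ψ_u(z) = 2 > 1. -/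
open MeasureTheory Set Filter

theorem convex_negOrth (n : ℕ) : Convex ℝ (negOrth n) := by
  have h : negOrth n = Set.univ.pi fun _ => Set.Iio (0 : ℝ) := by
    ext t
    simp [negOrth]
  rw [h]
  exact convex_pi fun _ _ => convex_Iio 0

theorem convexOn_apply_negOrth {n : ℕ} (j : Fin n) :
    ConvexOn ℝ (negOrth n) (fun t => t j) :=
  (LinearMap.proj (R := ℝ) (φ := fun _ : Fin n => ℝ) j).convexOn (convex_negOrth n)

theorem convexOn_neg_sqrt_neg_apply {n : ℕ} (j : Fin n) :
    ConvexOn ℝ (negOrth n) (fun t => -√(-(t j))) := by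
  have h := Real.strictConcaveOn_sqrt.concaveOn.comp_linearMap
    (-(LinearMap.proj (R := ℝ) (φ := fun _ : Fin n => ℝ) j))
  refine (h.neg).subset (fun t ht => ?_) (convex_negOrth n)
  have := ht j
  simp only [Set.mem_preimage, LinearMap.neg_apply, LinearMap.proj_apply, Set.mem_Ici]
  linarith

theorem tendsto_inv_mul_max_neg_sqrt {a b : ℝ} (hb : b < 0) :
    Tendsto (fun c : ℝ => c⁻¹ * max (-√(-(c * a))) (c * b)) atTop (nhds 0) := by
  have hlim : Tendsto (fun c : ℝ => -(√(-a) * (√c)⁻¹)) atTop (nhds 0) := by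
    simpa using ((tendsto_inv_atTop_zero.comp Real.tendsto_sqrt_atTop).const_mul (√(-a))).neg
  refine tendsto_of_tendsto_of_tendsto_of_le_of_le' hlim tendsto_const_nhds ?_ ?_
  · filter_upwards [eventually_gt_atTop 0] with c hc
    have hs : √c * √c = c := Real.mul_self_sqrt hc.le
    have hs0 : 0 < √c := Real.sqrt_pos.2 hc
    have h : -(√(-a) * (√c)⁻¹) = c⁻¹ * -√(-(c * a)) := by
      have hi : c⁻¹ = (√c)⁻¹ * (√c)⁻¹ := by rw [← mul_inv, hs]
      rw [← mul_neg c a, Real.sqrt_mul hc.le, hi]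
      field_simp
    rw [h]
    exact mul_le_mul_of_nonneg_left (le_max_left _ _) (inv_nonneg.2 hc.le)
  · filter_upwards [eventually_gt_atTop 0] with c hc
    exact mul_nonpos_of_nonneg_of_nonpos (inv_nonneg.2 hc.le)
      (max_le (neg_nonpos.2 (Real.sqrt_nonneg _)) (mul_neg_of_pos_of_neg hc hb).le)

theorem max_neg_sqrt_add_max_div_le_two {a b : ℝ} (h : max a b ≤ -1) :
    (max (-√(-a)) b + max a b) / max a b ≤ 2 := by
  have ha : a ≤ -1 := (le_max_left _ _).trans h
  have hs : √(-a) ≤ -a := Real.sqrt_le_iff.2 ⟨by linarith, by nlinarith⟩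
  have hm : max a b ≤ max (-√(-a)) b := max_le_max_right b (by linarith)
  rw [div_le_iff_of_neg (by linarith)]
  linarith

theorem max_neg_sqrt_add_max_div_eq_two {x : ℝ} (hx : 1 ≤ x) :
    (max (-√(-(-x ^ 2))) (-x) + max (-x ^ 2) (-x)) / max (-x ^ 2) (-x) = 2 := by
  have h : max (-x ^ 2) (-x) = -x := max_eq_right (by nlinarith)
  rw [h, neg_neg, Real.sqrt_sq (by linarith), max_self]
  have : x ≠ 0 := by linarith
  field_simp
  norm_num

theorem tendsto_neg_sq_neg :
    Tendsto (fun x : ℝ => (![-x ^ 2, -x] : Fin 2 → ℝ)) atTop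
      ((comap (fun t : Fin 2 → ℝ => max (t 0) (t 1)) atBot) ⊓
        Filter.principal (negOrth 2)) := by
  refine tendsto_inf.2 ⟨tendsto_comap_iff.2 ?_, tendsto_principal.2 ?_⟩
  · refine tendsto_neg_atTop_atBot.congr' ?_
    filter_upwards [eventually_ge_atTop 1] with x hx
    have h : max (-x ^ 2) (-x) = -x := max_eq_right (by nlinarith)
    simp [h]
  · filter_upwards [eventually_ge_atTop 1] with x hx j
    fin_cases j
    · simp only [Fin.zero_eta, Matrix.cons_val_zero]
      nlinarith
    · simp only [Fin.mk_one, Matrix.cons_val_one, Matrix.cons_val_fin_one]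
      linarith

/-- The function `w(t₁,t₂) = max(-√(-t₁), t₂) + max(t₁,t₂)`:
(i) belongs to `CNV₋`; (ii) has indicator `Ψ̂_w(t) = max(t₁,t₂)`; (iii) satisfies
`limsup w(t)/max(t₁,t₂) = 2` as `max(t₁,t₂) → -∞` within `ℝ²₋`. Hence there is a
multi-circled singularity with `limsup_{z→0} u/Ψ_u = 2 > 1`. -/
theorem example_ratio_two (w : (Fin 2 → ℝ) → ℝ)
    (hw : ∀ t, w t = max (-Real.sqrt (-(t 0))) (t 1) + max (t 0) (t 1)) :
    CNVm 2 w ∧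
    (∀ t ∈ negOrth 2,
      Tendsto (fun c : ℝ => c⁻¹ * w (c • t)) atTop (nhds (max (t 0) (t 1)))) ∧
    limsup (fun t : Fin 2 → ℝ => w t / max (t 0) (t 1))
      ((comap (fun t : Fin 2 → ℝ => max (t 0) (t 1)) atBot) ⊓
        Filter.principal (negOrth 2)) = 2 := by
  refine ⟨⟨?_, ?_, ?_⟩, ?_, ?_⟩
  · rw [funext hw]
    exact ((convexOn_neg_sqrt_neg_apply 0).sup (convexOn_apply_negOrth 1)).add
      ((convexOn_apply_negOrth 0).sup (convexOn_apply_negOrth 1))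
  · intro t ht
    rw [hw]
    exact add_neg (max_lt (neg_neg_of_pos (Real.sqrt_pos.2 (neg_pos.2 (ht 0)))) (ht 1))
      (max_lt (ht 0) (ht 1))
  · intro t _ s _ hts
    rw [hw, hw]
    exact add_le_add
      (max_le_max (neg_le_neg (Real.sqrt_le_sqrt (neg_le_neg (hts 0)))) (hts 1))
      (max_le_max (hts 0) (hts 1))
  · intro t ht
    have h := (tendsto_inv_mul_max_neg_sqrt (a := t 0) (ht 1)).add_const (max (t 0) (t 1))
    rw [zero_add] at h
    refine h.congr' ?_
    filter_upwards [eventually_gt_atTop 0] with c hc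
    rw [hw]
    simp only [Pi.smul_apply, smul_eq_mul]
    rw [← mul_max_of_nonneg (t 0) (t 1) hc.le, mul_add, inv_mul_cancel_left₀ hc.ne']
  · set F := (comap (fun t : Fin 2 → ℝ => max (t 0) (t 1)) atBot) ⊓
        Filter.principal (negOrth 2)
    have hle : ∀ᶠ t in F, w t / max (t 0) (t 1) ≤ 2 := by
      have h : ∀ᶠ t : Fin 2 → ℝ in F, max (t 0) (t 1) ≤ -1 :=
        (tendsto_comap.mono_left inf_le_left).eventually (eventually_le_atBot (-1))
      filter_upwards [h] with t ht
      rw [hw]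
      exact max_neg_sqrt_add_max_div_le_two ht
    have hge : ∃ᶠ t in F, 2 ≤ w t / max (t 0) (t 1) := by
      refine tendsto_neg_sq_neg.frequently (Eventually.frequently ?_)
      filter_upwards [eventually_ge_atTop 1] with x hx
      rw [hw]
      exact (max_neg_sqrt_add_max_div_eq_two hx).ge
    exact le_antisymm
      (limsup_le_of_le (IsCoboundedUnder.of_frequently_ge hge) hle)
      (le_limsup_of_frequently_le hge (isBoundedUnder_of_eventually_le hle))
end
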